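/- Let V : ℝⁿ → ℝ be of class C² with a unique global minimum at x★ ∈ ℝⁿ, where the Hessian matrix Hess V(x★) is positive definite. Assume moreover that e^{-V/ε₀} is integrable on ℝⁿ for some ε₀ > 0 and that for every δ > 0 the infimum of V over the complement of the ball of radius δ around x★ is strictly larger than V(x★). Then the Laplace asymptotics hold: lim_{ε → 0⁺} ε^{-n/2} ∫_{ℝⁿ} e^{-(V(x) - V(x★))/ε} dx = (2π)^{n/2} / √(det Hess V(x★)). -/

import Mathlib

open Real MeasureTheory Topology

theorem lap_taylor {E : Type*} [NormedAddCommGroup E] [NormedSpace ℝ E]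
    (V : E → ℝ) (hV : ContDiff ℝ 2 V) (a : E) (h0 : fderiv ℝ V a = 0) :
    (fun y => V (a + y) - V a - fderiv ℝ (fderiv ℝ V) a y y / 2) =o[𝓝 0]
      (fun y : E => ‖y‖ ^ 2) := by
  set B := fderiv ℝ (fderiv ℝ V) a with hB
  have hsymm : ∀ v w, B v w = B w v := by
    intro v w
    exact (hV.contDiffAt.isSymmSndFDerivAt (by simp)) v w
  have hdiff : Differentiable ℝ V := hV.differentiable (by norm_num)
  have hd2 : HasFDerivAt (fderiv ℝ V) B a := by
    have : ContDiff ℝ 1 (fderiv ℝ V) := hV.fderiv_right (by norm_num)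
    exact (this.differentiable (by norm_num) a).hasFDerivAt
  have hlo := hasFDerivAt_iff_isLittleO_nhds_zero.1 hd2
  rw [h0] at hlo
  have hder : ∀ y, HasFDerivAt (fun y => V (a + y) - V a - B y y / 2)
      (fderiv ℝ V (a + y) - B y) y := by
    intro y
    have h1 : HasFDerivAt (fun y => V (a + y)) (fderiv ℝ V (a + y)) y := by
      have := (hdiff (a + y)).hasFDerivAt
      exact (hasFDerivAt_comp_add_left a).2 this
    have h2 : HasFDerivAt (fun y => B y y) _ y := B.hasFDerivAt.clm_apply (hasFDerivAt_id y)
    convert! (h1.sub_const (V a)).sub (h2.mul_const (2⁻¹ : ℝ)) using 1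
    ext w
    simp [hsymm w y]
    ring
  rw [Asymptotics.isLittleO_iff]
  intro c hc
  have := (Asymptotics.isLittleO_iff.1 hlo) hc
  obtain ⟨r, hr, hball⟩ := Metric.eventually_nhds_iff_ball.1 this
  filter_upwards [Metric.ball_mem_nhds (0 : E) hr] with y hy
  have key := (convex_closedBall (0 : E) ‖y‖).norm_image_sub_le_of_norm_hasFDerivWithin_le
    (f := fun y => V (a + y) - V a - B y y / 2) (C := c * ‖y‖) (x := 0) (y := y)
    (fun z _ => (hder z).hasFDerivWithinAt) (fun z hz => by
      have hz' : ‖z‖ ≤ ‖y‖ := by simpa using hz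
      have hy' : ‖y‖ < r := by simpa using hy
      have := hball z (by simpa using hz'.trans_lt hy')
      simp only [sub_zero] at this
      exact this.trans (by gcongr)) (by simp) (by simp)
  simp at key
  simp
  nlinarith [key]

theorem lap_core {E : Type*} [NormedAddCommGroup E] [InnerProductSpace ℝ E]
    [FiniteDimensional ℝ E] [MeasurableSpace E] [BorelSpace E]
    (W q : E → ℝ) (hW : Continuous W) (hW0 : ∀ y, 0 ≤ W y)
    (hq : ∀ (t : ℝ) y, q (t • y) = t ^ 2 * q y)
    (c : ℝ) (hc : 0 < c) (hqc : ∀ y, c * ‖y‖ ^ 2 ≤ q y)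
    (hlo : (fun y => W y - q y) =o[𝓝 0] (fun y : E => ‖y‖ ^ 2))
    (ε₀ : ℝ) (hε₀ : 0 < ε₀) (hint : Integrable (fun x => Real.exp (-W x / ε₀)))
    (hconf : ∀ δ > (0:ℝ), ∃ η > 0, ∀ x, δ ≤ ‖x‖ → η ≤ W x) :
    Filter.Tendsto
      (fun ε : ℝ => ε ^ (-(Module.finrank ℝ E : ℝ) / 2) * ∫ x, Real.exp (-W x / ε))
      (𝓝[>] (0:ℝ)) (𝓝 (∫ y, Real.exp (-q y))) := by
  -- local quadratic lower bound
  obtain ⟨δ, hδ, hloc⟩ : ∃ δ > 0, ∀ y : E, ‖y‖ < δ → c / 2 * ‖y‖ ^ 2 ≤ W y := by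
    have := (Asymptotics.isLittleO_iff.1 hlo) (half_pos hc)
    obtain ⟨r, hr, hball⟩ := Metric.eventually_nhds_iff_ball.1 this
    refine ⟨r, hr, fun y hy => ?_⟩
    have h1 := hball y (by simpa using hy)
    rw [Real.norm_eq_abs, Real.norm_eq_abs, abs_of_nonneg (by positivity : 0 ≤ ‖y‖ ^ 2)] at h1
    have := (abs_le.1 h1).1
    linarith [hqc y]
  obtain ⟨η, hη, hout⟩ := hconf δ hδ
  set s : Set E := {y | ‖y‖ < δ} with hs
  have hsm : MeasurableSet s := (isOpen_lt continuous_norm continuous_const).measurableSet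
  set d := Module.finrank ℝ E with hd
  have hpow : ∀ ε : ℝ, 0 < ε → ε ^ (-(d : ℝ) / 2) = ((√ε) ^ d)⁻¹ := by
    intro ε hε
    rw [Real.sqrt_eq_rpow, ← Real.rpow_natCast, ← Real.rpow_mul hε.le, ← Real.rpow_neg hε.le]
    congr 1; ring
  have hintε : ∀ ε : ℝ, 0 < ε → ε ≤ ε₀ → Integrable (fun x => Real.exp (-W x / ε)) := by
    intro ε hε hle
    refine hint.mono' (by fun_prop) (Filter.Eventually.of_forall fun x => ?_)
    rw [Real.norm_eq_abs, abs_of_pos (Real.exp_pos _)]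
    apply Real.exp_le_exp.2
    rw [neg_div, neg_div]
    have := div_le_div_of_nonneg_left (hW0 x) hε hle
    linarith
  have hsmall : ∀ᶠ ε : ℝ in 𝓝[>] 0, 0 < ε ∧ ε ≤ ε₀ := by
    filter_upwards [Ioc_mem_nhdsGT hε₀] with ε h using h
  -- inner part
  have hin : Filter.Tendsto (fun ε : ℝ => ∫ y, s.indicator (fun x => Real.exp (-W x / ε)) (√ε • y))
      (𝓝[>] (0:ℝ)) (𝓝 (∫ y, Real.exp (-q y))) := by
    refine tendsto_integral_filter_of_dominated_convergence (fun y => Real.exp (-(c/2) * ‖y‖ ^ 2))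
      ?_ ?_ ?_ ?_
    · filter_upwards with ε
      have : Measurable (s.indicator (fun x => Real.exp (-W x / ε))) :=
        Measurable.indicator (by fun_prop) hsm
      exact (this.comp (by fun_prop)).aestronglyMeasurable
    · filter_upwards [hsmall] with ε ⟨hε, _⟩
      filter_upwards with y
      by_cases hy : √ε • y ∈ s
      · rw [Set.indicator_of_mem hy, Real.norm_eq_abs, abs_of_pos (Real.exp_pos _)]
        apply Real.exp_le_exp.2
        have := hloc _ hy
        rw [norm_smul, Real.norm_eq_abs, abs_of_nonneg (Real.sqrt_nonneg _), mul_pow,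
          Real.sq_sqrt hε.le] at this
        rw [div_le_iff₀ hε]
        linarith
      · rw [Set.indicator_of_notMem hy]; simp [Real.exp_nonneg]
    · have h := GaussianFourier.integral_rexp_neg_mul_sq_norm (V := E) (half_pos hc)
      by_contra hn
      rw [integral_undef hn] at h
      have : 0 < (π / (c/2)) ^ ((Module.finrank ℝ E : ℝ) / 2) := by positivity
      linarith
    · filter_upwards with y
      have hsq : Filter.Tendsto (fun ε : ℝ => √ε • y) (𝓝[>] 0) (𝓝 0) := by
        have : Filter.Tendsto (fun ε : ℝ => √ε • y) (𝓝 0) (𝓝 (√0 • y)) :=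
          Continuous.tendsto (by fun_prop) 0
        simp only [Real.sqrt_zero, zero_smul] at this
        exact this.mono_left nhdsWithin_le_nhds
      have hmem : ∀ᶠ ε : ℝ in 𝓝[>] 0, √ε • y ∈ s := by
        apply hsq
        exact (isOpen_lt continuous_norm continuous_const).mem_nhds (by simpa using hδ)
      have hlim : Filter.Tendsto (fun ε : ℝ => W (√ε • y) / ε) (𝓝[>] 0) (𝓝 (q y)) := by
        have h1 := hlo.comp_tendsto hsq
        have h2 : (fun ε : ℝ => W (√ε • y) - ε * q y) =o[𝓝[>] 0] (fun ε : ℝ => ε) := by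
          have h3 : (fun ε : ℝ => W (√ε • y) - ε * q y) =o[𝓝[>] 0]
              (fun ε : ℝ => ‖y‖ ^ 2 * ε) := by
            refine h1.congr' ?_ ?_
            · filter_upwards [hsmall] with ε hε
              simp [hq, Real.sq_sqrt hε.1.le]
            · filter_upwards [hsmall] with ε hε
              simp [norm_smul, mul_pow, Real.sq_sqrt hε.1.le, mul_comm]
          exact h3.trans_isBigO (Asymptotics.isBigO_const_mul_self _ _ _)
        have h4 := h2.tendsto_div_nhds_zero
        have h5 := h4.add_const (q y)
        rw [zero_add] at h5
        refine h5.congr' ?_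
        filter_upwards [hsmall] with ε hε
        have := hε.1.ne'
        field_simp
        ring
      have := (Real.continuous_exp.tendsto _).comp hlim.neg
      refine this.congr' ?_
      filter_upwards [hmem] with ε h
      rw [Set.indicator_of_mem h]
      simp [neg_div]
  -- outer part
  have houter : Filter.Tendsto (fun ε : ℝ => ε ^ (-(d : ℝ) / 2) *
      ∫ x in sᶜ, Real.exp (-W x / ε)) (𝓝[>] (0:ℝ)) (𝓝 0) := by
    set C := Real.exp (η / ε₀) * ∫ x, Real.exp (-W x / ε₀) with hC
    have hb : Filter.Tendsto (fun ε : ℝ => (ε⁻¹ ^ ((d : ℝ) / 2) * Real.exp (-η * ε⁻¹)) * C)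
        (𝓝[>] (0:ℝ)) (𝓝 0) := by
      have := ((tendsto_rpow_mul_exp_neg_mul_atTop_nhds_zero ((d:ℝ)/2) η hη).comp
        tendsto_inv_nhdsGT_zero).mul_const C
      simpa using this
    refine squeeze_zero' ?_ ?_ hb
    · filter_upwards [hsmall] with ε ⟨hε, _⟩
      have : 0 ≤ ∫ x in sᶜ, Real.exp (-W x / ε) := integral_nonneg fun x => Real.exp_nonneg _
      positivity
    · filter_upwards [hsmall] with ε ⟨hε, hle⟩
      have h1 : ∫ x in sᶜ, Real.exp (-W x / ε) ≤
          ∫ x in sᶜ, (Real.exp (-η * ε⁻¹) * Real.exp (η / ε₀)) * Real.exp (-W x / ε₀) := by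
        refine setIntegral_mono_on (hintε ε hε hle).integrableOn
          (hint.const_mul _).integrableOn hsm.compl fun x hx => ?_
        rw [← Real.exp_add, ← Real.exp_add]
        apply Real.exp_le_exp.2
        have hx' : η ≤ W x := hout x (not_lt.1 hx)
        have h2 : 0 ≤ ε⁻¹ - ε₀⁻¹ := sub_nonneg.2 (inv_anti₀ hε hle)
        simp only [div_eq_mul_inv]
        nlinarith [mul_nonneg (sub_nonneg.2 hx') h2]
      have h2 : ∫ x in sᶜ, (Real.exp (-η * ε⁻¹) * Real.exp (η / ε₀)) * Real.exp (-W x / ε₀) ≤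
          ∫ x, (Real.exp (-η * ε⁻¹) * Real.exp (η / ε₀)) * Real.exp (-W x / ε₀) :=
        setIntegral_le_integral (hint.const_mul _)
          (Filter.Eventually.of_forall fun x => by positivity)
      have h12 := h1.trans h2
      rw [integral_const_mul] at h12
      have h3 : ε ^ (-(d : ℝ) / 2) = ε⁻¹ ^ ((d : ℝ) / 2) := by
        rw [Real.inv_rpow hε.le, ← Real.rpow_neg hε.le, neg_div]
      rw [h3, hC, mul_assoc]
      have : 0 ≤ ε⁻¹ ^ ((d : ℝ) / 2) := by positivity
      refine mul_le_mul_of_nonneg_left ?_ this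
      linarith [h12]
  have := hin.add houter
  rw [add_zero] at this
  refine this.congr' ?_
  filter_upwards [hsmall] with ε ⟨hε, hle⟩
  rw [Measure.integral_comp_smul_of_nonneg volume _ _ (hR := Real.sqrt_nonneg ε), smul_eq_mul,
    integral_indicator hsm, hpow ε hε, ← mul_add, integral_add_compl hsm (hintε ε hε hle)]

open scoped MatrixOrder Matrix in
theorem lap_sqrt {n : ℕ} (H : Matrix (Fin n) (Fin n) ℝ) (hp : H.PosDef) :
    ∃ S : Matrix (Fin n) (Fin n) ℝ, H = Sᵀ * S := by
  have h : (0 : Matrix (Fin n) (Fin n) ℝ) ≤ H := Matrix.nonneg_iff_posSemidef.2 hp.posSemidef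
  obtain ⟨S, hS⟩ := CStarAlgebra.nonneg_iff_eq_star_mul_self.1 h
  exact ⟨S, by simpa [Matrix.star_eq_conjTranspose] using hS⟩

open scoped Matrix in
theorem lap_quad {n : ℕ} (B : EuclideanSpace ℝ (Fin n) →L[ℝ] EuclideanSpace ℝ (Fin n) →L[ℝ] ℝ)
    (S : Matrix (Fin n) (Fin n) ℝ)
    (h : ∀ i j, (Sᵀ * S) i j = B (EuclideanSpace.single i 1) (EuclideanSpace.single j 1))
    (y : EuclideanSpace ℝ (Fin n)) : B y y = ‖Matrix.toLpLin 2 2 S y‖ ^ 2 := by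
  have hy : y = ∑ i, y i • EuclideanSpace.single i (1:ℝ) := by
    ext k
    simp [Finset.sum_apply, Pi.single_apply]
  have h1 : B y y = ∑ i, ∑ j, y i * (y j * (Sᵀ * S) i j) := by
    conv_lhs => rw [hy]
    simp [h, Finset.mul_sum, map_sum]
    rw [Finset.sum_comm]
    exact Finset.sum_congr rfl fun i _ => Finset.sum_congr rfl fun j _ => by ring
  have h2 : ‖Matrix.toLpLin 2 2 S y‖ ^ 2 = (S *ᵥ y.ofLp) ⬝ᵥ (S *ᵥ y.ofLp) := by
    rw [EuclideanSpace.real_norm_sq_eq]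
    simp [dotProduct, sq]
  rw [h1, h2, Matrix.dotProduct_mulVec, Matrix.vecMul_mulVec, ← Matrix.mulVec_transpose]
  simp [Matrix.mulVec, dotProduct, Finset.mul_sum, mul_comm, mul_left_comm]
  rw [Finset.sum_comm]
  exact Finset.sum_congr rfl fun i _ => Finset.sum_congr rfl fun j _ => by ring

theorem lap_gauss {n : ℕ} (S : Matrix (Fin n) (Fin n) ℝ) (hS : S.det ≠ 0) :
    ∫ y : EuclideanSpace ℝ (Fin n), Real.exp (-(‖Matrix.toLpLin 2 2 S y‖ ^ 2 / 2)) =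
      (2 * π) ^ ((n : ℝ) / 2) / |S.det| := by
  have hdet : LinearMap.det (Matrix.toLpLin 2 2 S) = S.det := LinearMap.det_toLpLin 2 S
  have hmap := Measure.map_linearMap_addHaar_eq_smul_addHaar
    (volume : Measure (EuclideanSpace ℝ (Fin n))) (f := Matrix.toLpLin 2 2 S)
    (by rw [hdet]; exact hS)
  have hcont : Continuous (Matrix.toLpLin 2 2 S : EuclideanSpace ℝ (Fin n) →ₗ[ℝ] _) :=
    LinearMap.continuous_of_finiteDimensional _
  have h1 := integral_map (μ := (volume : Measure (EuclideanSpace ℝ (Fin n))))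
    hcont.measurable.aemeasurable
    (f := fun z : EuclideanSpace ℝ (Fin n) => Real.exp (-(1/2) * ‖z‖ ^ 2)) (by fun_prop)
  rw [hmap, integral_smul_measure, hdet, ENNReal.toReal_ofReal (abs_nonneg _),
    GaussianFourier.integral_rexp_neg_mul_sq_norm (by norm_num)] at h1
  have h2 : ∀ y : EuclideanSpace ℝ (Fin n), -(‖Matrix.toLpLin 2 2 S y‖ ^ 2 / 2) =
    -(1/2) * ‖Matrix.toLpLin 2 2 S y‖ ^ 2 := fun y => by ring
  simp_rw [h2]
  rw [← h1, finrank_euclideanSpace_fin, abs_inv, smul_eq_mul]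
  rw [show π / (1/2) = 2 * π by ring]
  field_simp



/-- Laplace asymptotics: for a `C²` confining potential `V` with unique global
minimum `x★` and positive definite Hessian there,
`ε^{-n/2} ∫ e^{-(V(x)-V(x★))/ε} dx → (2π)^{n/2} / √(det Hess V(x★))` as `ε → 0⁺`. -/
theorem laplace_asymptotics (n : ℕ)
    (V : EuclideanSpace ℝ (Fin n) → ℝ) (hV : ContDiff ℝ 2 V)
    (xstar : EuclideanSpace ℝ (Fin n))
    (hmin : ∀ x, x ≠ xstar → V xstar < V x)
    (H : Matrix (Fin n) (Fin n) ℝ)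
    (hH : ∀ i j, H i j =
      fderiv ℝ (fun y => fderiv ℝ V y (EuclideanSpace.single j 1)) xstar
        (EuclideanSpace.single i 1))
    (hposdef : H.PosDef)
    (hint : ∃ ε₀ > (0:ℝ), Integrable (fun x => Real.exp (-V x / ε₀)))
    (hconf : ∀ δ > (0:ℝ), ∃ c > V xstar, ∀ x, δ ≤ ‖x - xstar‖ → c ≤ V x) :
    Filter.Tendsto
      (fun ε : ℝ => ε ^ (-(n : ℝ) / 2) *
        ∫ x, Real.exp (-(V x - V xstar) / ε))
      (𝓝[>] (0:ℝ))
      (𝓝 ((2 * π) ^ ((n : ℝ) / 2) / Real.sqrt H.det)) := by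
  obtain ⟨S, hS⟩ := lap_sqrt H hposdef
  have hdetH : H.det = S.det ^ 2 := by rw [hS, Matrix.det_mul, Matrix.det_transpose, sq]
  have hS0 : S.det ≠ 0 := by
    intro h
    have := hposdef.det_pos
    rw [hdetH, h] at this
    simp at this
  have hmin' : ∀ x, V xstar ≤ V x := fun x => by
    by_cases h : x = xstar
    · rw [h]
    · exact (hmin x h).le
  have h0 : fderiv ℝ V xstar = 0 :=
    IsLocalMin.fderiv_eq_zero (Filter.Eventually.of_forall hmin')
  have hd1 : DifferentiableAt ℝ (fderiv ℝ V) xstar := by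
    have : ContDiff ℝ 1 (fderiv ℝ V) := hV.fderiv_right (by norm_num)
    exact this.differentiable (by norm_num) xstar
  set L := (Matrix.toLpLin 2 2 S : EuclideanSpace ℝ (Fin n) →ₗ[ℝ] EuclideanSpace ℝ (Fin n))
    with hL
  have hquad : ∀ y, fderiv ℝ (fderiv ℝ V) xstar y y = ‖L y‖ ^ 2 := by
    refine lap_quad _ S fun i j => ?_
    rw [← hS, hH i j, fderiv_clm_apply hd1 (by fun_prop)]
    simp
  have hlo := lap_taylor V hV xstar h0
  simp_rw [hquad] at hlo
  have hker : LinearMap.ker L = ⊥ := by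
    by_contra hk
    have := LinearMap.bot_lt_ker_of_det_eq_zero (f := L)
    have hdet : LinearMap.det L = S.det := LinearMap.det_toLpLin 2 S
    have hu : IsUnit (LinearMap.det L) := by rw [hdet]; exact hS0.isUnit
    exact hk ((LinearMap.isUnit_iff_ker_eq_bot L).1 ((LinearMap.isUnit_iff_isUnit_det L).2 hu))
  obtain ⟨K, hK, hanti⟩ := L.exists_antilipschitzWith hker
  have hbound : ∀ y, ‖y‖ ≤ K * ‖L y‖ := fun y => by
    simpa using hanti.le_mul_dist y 0
  have hK' : (0:ℝ) < K := hK
  obtain ⟨ε₀, hε₀, hi⟩ := hint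
  have hi' : Integrable (fun y => Real.exp (-(V (xstar + y) - V xstar) / ε₀)) := by
    have := (hi.comp_add_left xstar).mul_const (Real.exp (V xstar / ε₀))
    refine this.congr (Filter.Eventually.of_forall fun y => ?_)
    simp only
    rw [← Real.exp_add]
    congr 1
    ring
  have key := lap_core (fun y => V (xstar + y) - V xstar) (fun y => ‖L y‖ ^ 2 / 2)
    (by have := hV.continuous; fun_prop) (fun y => sub_nonneg.2 (hmin' _))
    (fun t y => by
      rw [map_smul, norm_smul, mul_pow, Real.norm_eq_abs, sq_abs]; ring)
    (1 / (2 * (K:ℝ) ^ 2)) (by positivity)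
    (fun y => by
      have h1 : ‖y‖ ^ 2 ≤ (K * ‖L y‖) ^ 2 := pow_le_pow_left₀ (norm_nonneg _) (hbound y) 2
      rw [div_mul_eq_mul_div, div_le_iff₀ (by positivity)]
      nlinarith [h1])
    hlo ε₀ hε₀ hi'
    (fun δ hδ => by
      obtain ⟨c, hc, h⟩ := hconf δ hδ
      refine ⟨c - V xstar, sub_pos.2 hc, fun x hx => ?_⟩
      have := h (xstar + x) (by simpa using hx)
      linarith)
  rw [lap_gauss S hS0, finrank_euclideanSpace_fin] at key
  rw [hdetH, Real.sqrt_sq_eq_abs]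
  refine key.congr fun ε => ?_
  congr 1
  exact integral_add_left_eq_self (fun x => Real.exp (-(V x - V xstar) / ε)) xstar
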